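/- arXiv:2003.06855 — 2 statements merged into one kernel-verified Lean document; each statement's English description precedes it below -/
import Mathlib

section
/- For 2n×n real matrices Y, Ŷ each satisfying rank Y = n, XᵀU = UᵀX (where Y = (X;U)), the comparative index μ(Y,Ŷ) := rank M + ind D and dual comparative index μ*(Y,Ŷ) := rank M + ind(−D) (with M = (I − XX†)X̂, T = I − M†M, D = T w(Y,Ŷ)ᵀ X† X̂ T, w(Y,Ŷ) = Yᵀ J Ŷ) satisfy the bound max{μ(Y,Ŷ), μ*(Y,Ŷ)} ≤ min{rank X̂, rank w(Y,Ŷ)} ≤ n. -/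
open Matrix
noncomputable section

/-- The standard symplectic matrix `J = [[0, I], [-I, 0]]`. -/
def Jmat (k : Type*) [Fintype k] [DecidableEq k] : Matrix (k ⊕ k) (k ⊕ k) ℝ :=
  fromBlocks 0 1 (-1) 0

/-- A matrix `S` is symplectic if `Sᵀ J S = J`. -/
def IsSymplectic {k : Type*} [Fintype k] [DecidableEq k]
    (S : Matrix (k ⊕ k) (k ⊕ k) ℝ) : Prop :=
  Sᵀ * Jmat k * S = Jmat k

/-- `S'` is the (entrywise) derivative family of the matrix family `S`. -/
def HasMatDeriv {k m : Type*} (S S' : ℝ → Matrix k m ℝ) : Prop :=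
  ∀ (l : ℝ) (i : k) (j : m), HasDerivAt (fun t => S t i j) (S' l i j) l

/-- `Ψ(S(λ)) = Jᵀ S'(λ) S(λ)⁻¹`, where `S'` is a derivative family of `S`. -/
def Psi {k : Type*} [Fintype k] [DecidableEq k]
    (S S' : ℝ → Matrix (k ⊕ k) (k ⊕ k) ℝ) (l : ℝ) : Matrix (k ⊕ k) (k ⊕ k) ℝ :=
  (Jmat k)ᵀ * S' l * (S l)⁻¹

open Classical in
/-- The Moore–Penrose pseudoinverse, defined via the four Penrose conditions. -/
def pinv {m k : Type*} [Fintype m] [Fintype k] (A : Matrix m k ℝ) : Matrix k m ℝ :=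
  if h : ∃ B : Matrix k m ℝ,
      A * B * A = A ∧ B * A * B = B ∧ (A * B)ᵀ = A * B ∧ (B * A)ᵀ = B * A
  then h.choose else 0

/-- `ind A`: the number of negative eigenvalues (with multiplicity) of a symmetric matrix. -/
def negInd {k : Type*} [Fintype k] [DecidableEq k] (A : Matrix k k ℝ) : ℕ :=
  if h : A.IsHermitian then Fintype.card {i // h.eigenvalues i < 0} else 0

/-- The Wronskian `w(Y, Ŷ) = Yᵀ J Ŷ`. -/
def wron {k m : Type*} [Fintype k] [Fintype m] [DecidableEq k]
    (Y Yh : Matrix (k ⊕ k) m ℝ) : Matrix m m ℝ :=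
  Yᵀ * Jmat k * Yh

/-- The matrix `M = (I − X X†) X̂` from the definition of the comparative index. -/
def compM {k m : Type*} [Fintype k] [Fintype m] [DecidableEq k]
    (Y Yh : Matrix (k ⊕ k) m ℝ) : Matrix k m ℝ :=
  let X := Y.submatrix Sum.inl id
  let Xh := Yh.submatrix Sum.inl id
  Xh - X * pinv X * Xh

/-- The matrix `D = T w(Y,Ŷ)ᵀ X† X̂ T` (with `T = I − M† M`) from the comparative index. -/
def compD {k m : Type*} [Fintype k] [Fintype m] [DecidableEq k] [DecidableEq m]
    (Y Yh : Matrix (k ⊕ k) m ℝ) : Matrix m m ℝ :=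
  let X := Y.submatrix Sum.inl id
  let Xh := Yh.submatrix Sum.inl id
  let T : Matrix m m ℝ := 1 - pinv (compM Y Yh) * compM Y Yh
  T * (wron Y Yh)ᵀ * pinv X * Xh * T

/-- The comparative index `μ(Y, Ŷ) = rank M + ind D`. -/
def compIdx {k m : Type*} [Fintype k] [Fintype m] [DecidableEq k] [DecidableEq m]
    (Y Yh : Matrix (k ⊕ k) m ℝ) : ℕ :=
  (compM Y Yh).rank + negInd (compD Y Yh)

/-- The dual comparative index `μ*(Y, Ŷ) = rank M + ind (−D)`. -/
def dualCompIdx {k m : Type*} [Fintype k] [Fintype m] [DecidableEq k] [DecidableEq m]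
    (Y Yh : Matrix (k ⊕ k) m ℝ) : ℕ :=
  (compM Y Yh).rank + negInd (-(compD Y Yh))

/-- A `2n×n` matrix `Y = (X; U)` is a conjoined basis: `rank Y = n` and `Xᵀ U` symmetric. -/
def IsConjoinedBasis {k m : Type*} [Fintype k] [Fintype m] [DecidableEq k]
    (Y : Matrix (k ⊕ k) m ℝ) : Prop :=
  Y.rank = Fintype.card m ∧ ((Y.submatrix Sum.inl id)ᵀ * Y.submatrix Sum.inr id).IsSymm


lemma pinv_exists {m k : Type*} [Fintype m] [Fintype k] (A : Matrix m k ℝ) :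
    ∃ B : Matrix k m ℝ,
      A * B * A = A ∧ B * A * B = B ∧ (A * B)ᵀ = A * B ∧ (B * A)ᵀ = B * A := by
  classical
  have hS : (Aᵀ * A).IsHermitian := by
    simpa [conjTranspose_eq_transpose_of_trivial] using isHermitian_conjTranspose_mul_self A
  obtain ⟨P, hP1, hP2⟩ : ∃ P : Matrix k k ℝ, Pᵀ * P = 1 ∧
      Aᵀ * A = P * diagonal hS.eigenvalues * Pᵀ := by
    refine ⟨(hS.eigenvectorUnitary : Matrix k k ℝ), ?_, ?_⟩
    · have := Unitary.coe_star_mul_self hS.eigenvectorUnitary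
      simpa [star_eq_conjTranspose, conjTranspose_eq_transpose_of_trivial] using this
    · have := hS.spectral_theorem
      rw [Unitary.conjStarAlgAut_apply] at this
      simpa [star_eq_conjTranspose, conjTranspose_eq_transpose_of_trivial,
        Function.comp_def] using this
  set d := hS.eigenvalues
  have key : ∀ a b : k → ℝ, (P * diagonal a * Pᵀ) * (P * diagonal b * Pᵀ)
      = P * diagonal (fun i => a i * b i) * Pᵀ := by
    intro a b
    calc (P * diagonal a * Pᵀ) * (P * diagonal b * Pᵀ)
        = P * diagonal a * (Pᵀ * P) * diagonal b * Pᵀ := by simp only [Matrix.mul_assoc]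
      _ = _ := by rw [hP1, Matrix.mul_one, Matrix.mul_assoc P, diagonal_mul_diagonal]
  have keyT : ∀ a : k → ℝ, (P * diagonal a * Pᵀ)ᵀ = P * diagonal a * Pᵀ := by
    intro a; simp [transpose_mul, Matrix.mul_assoc]
  obtain ⟨R, hR⟩ : ∃ R, R = P * diagonal (fun i => (d i)⁻¹) * Pᵀ := ⟨_, rfl⟩
  have hRT : Rᵀ = R := by rw [hR, keyT]
  have hRS : (R * (Aᵀ * A))ᵀ = R * (Aᵀ * A) := by rw [hP2, hR, key, keyT]
  have hRSR : R * (Aᵀ * A) * R = R := by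
    rw [hP2, hR, key, key]
    congr 3; ext i
    by_cases h : d i = 0 <;> simp [h]
  have hSRS : (Aᵀ * A) * (R * (Aᵀ * A)) = Aᵀ * A := by
    rw [hP2, hR, key, key]
    congr 3; ext i
    by_cases h : d i = 0 <;> simp [h]
  refine ⟨R * Aᵀ, ?_, ?_, ?_, ?_⟩
  · have h0 : (A * (R * (Aᵀ * A)) - A)ᵀ * (A * (R * (Aᵀ * A)) - A) = 0 := by
      have : Aᵀ * (A * (R * (Aᵀ * A)) - A) = 0 := by
        rw [Matrix.mul_sub, ← Matrix.mul_assoc, hSRS, sub_self]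
      rw [transpose_sub, transpose_mul, Matrix.sub_mul, Matrix.mul_assoc, this]
      simp
    have h1 : A * (R * (Aᵀ * A)) - A = 0 := by
      rw [← conjTranspose_eq_transpose_of_trivial] at h0
      exact conjTranspose_mul_self_eq_zero.mp h0
    simpa only [Matrix.mul_assoc] using sub_eq_zero.mp h1
  · calc R * Aᵀ * A * (R * Aᵀ) = R * (Aᵀ * A) * R * Aᵀ := by simp only [Matrix.mul_assoc]
      _ = _ := by rw [hRSR]
  · rw [transpose_mul, transpose_mul, transpose_transpose, hRT, Matrix.mul_assoc]
  · rw [Matrix.mul_assoc, hRS]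

lemma pinv_spec {m k : Type*} [Fintype m] [Fintype k] (A : Matrix m k ℝ) :
    A * pinv A * A = A ∧ pinv A * A * pinv A = pinv A ∧ (A * pinv A)ᵀ = A * pinv A ∧
      (pinv A * A)ᵀ = pinv A * A := by
  have h := pinv_exists A
  rw [pinv, dif_pos h]
  exact h.choose_spec

lemma negInd_le_rank {k : Type*} [Fintype k] [DecidableEq k] (A : Matrix k k ℝ) :
    negInd A ≤ A.rank := by
  unfold negInd
  split_ifs with h
  · rw [h.rank_eq_card_non_zero_eigs]
    exact Fintype.card_subtype_mono _ _ (fun i hi => ne_of_lt hi)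
  · exact Nat.zero_le _

lemma rank_add_rank_le {k l m : Type*} [Fintype k] [Fintype l] [Fintype m]
    [DecidableEq m]
    (A : Matrix k m ℝ) (M : Matrix l m ℝ) (T : Matrix m m ℝ)
    (hker : ∀ v, A *ᵥ v = 0 → M *ᵥ v = 0) (hMT : M * T = 0) :
    M.rank + (A * T).rank ≤ A.rank := by
  have hle : LinearMap.ker A.mulVecLin ≤ LinearMap.ker M.mulVecLin := by
    intro v hv
    simpa using hker v (by simpa using hv)
  have h1 := LinearMap.finrank_range_add_finrank_ker
    (A.mulVecLin.domRestrict (LinearMap.ker M.mulVecLin))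
  have h2 := LinearMap.finrank_range_add_finrank_ker A.mulVecLin
  have h3 := LinearMap.finrank_range_add_finrank_ker M.mulVecLin
  have h4 : Module.finrank ℝ
      (LinearMap.ker (A.mulVecLin.domRestrict (LinearMap.ker M.mulVecLin)))
      = Module.finrank ℝ (LinearMap.ker A.mulVecLin) := by
    rw [LinearMap.ker_domRestrict]
    exact (Submodule.comapSubtypeEquivOfLe hle).finrank_eq
  have h5 : (A * T).rank ≤ Module.finrank ℝ
      (LinearMap.range (A.mulVecLin.domRestrict (LinearMap.ker M.mulVecLin))) := by
    apply Submodule.finrank_mono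
    rintro _ ⟨v, rfl⟩
    refine ⟨⟨T *ᵥ v, ?_⟩, ?_⟩
    · simp [hMT]
    · simp
  unfold Matrix.rank at *
  omega

lemma lagr {n : ℕ} (Y : Matrix (Fin n ⊕ Fin n) (Fin n) ℝ) (hr : Y.rank = n)
    (h0 : Yᵀ * Jmat (Fin n) * Y = 0) (z : Fin n ⊕ Fin n → ℝ)
    (hz : (Yᵀ * Jmat (Fin n)) *ᵥ z = 0) : ∃ c, z = Y *ᵥ c := by
  have hJ : IsUnit (Jmat (Fin n)) := by
    refine IsUnit.of_mul_eq_one (-Jmat (Fin n)) ?_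
    simp [Jmat, fromBlocks_multiply, fromBlocks_neg]
  have hrk : (Yᵀ * Jmat (Fin n)).rank = n := by
    rw [rank_mul_eq_left_of_isUnit_det _ _ ((isUnit_iff_isUnit_det _).mp hJ), rank_transpose, hr]
  have hle : LinearMap.range Y.mulVecLin ≤ LinearMap.ker (Yᵀ * Jmat (Fin n)).mulVecLin := by
    rintro _ ⟨v, rfl⟩
    simp only [LinearMap.mem_ker, mulVecLin_apply, mulVec_mulVec, h0, zero_mulVec]
  have h1 := LinearMap.finrank_range_add_finrank_ker (Yᵀ * Jmat (Fin n)).mulVecLin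
  have heq := Submodule.eq_of_le_of_finrank_eq hle (by
    unfold Matrix.rank at hr hrk
    simp at h1
    omega)
  have : z ∈ LinearMap.range Y.mulVecLin := by
    rw [heq]; exact hz
  obtain ⟨c, hc⟩ := this
  exact ⟨c, hc.symm⟩

lemma wron_eq {n : ℕ} (Y Yh : Matrix (Fin n ⊕ Fin n) (Fin n) ℝ) :
    wron Y Yh = (Y.submatrix Sum.inl id)ᵀ * Yh.submatrix Sum.inr id
      - (Y.submatrix Sum.inr id)ᵀ * Yh.submatrix Sum.inl id := by
  have h : ∀ Z : Matrix (Fin n ⊕ Fin n) (Fin n) ℝ,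
      Z = fromRows (Z.submatrix Sum.inl id) (Z.submatrix Sum.inr id) := by
    intro Z; ext (i | i) j <;> rfl
  unfold wron Jmat
  conv_lhs => rw [h Y, h Yh]
  rw [transpose_fromRows, fromCols_mul_fromBlocks, fromCols_mul_fromRows]
  simp [sub_eq_add_neg, add_comm]

/-- `D` is symmetric, and
`max{μ(Y,Ŷ), μ*(Y,Ŷ)} ≤ min{rank X̂, rank w(Y,Ŷ)} ≤ n`. -/
theorem statement9 (n : ℕ) (Y Yh : Matrix (Fin n ⊕ Fin n) (Fin n) ℝ)
    (hY : IsConjoinedBasis Y) (hYh : IsConjoinedBasis Yh) :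
    (compD Y Yh).IsSymm ∧
    max (compIdx Y Yh) (dualCompIdx Y Yh)
      ≤ min (Yh.submatrix Sum.inl id).rank (wron Y Yh).rank ∧
    min (Yh.submatrix Sum.inl id).rank (wron Y Yh).rank ≤ n := by
  obtain ⟨hYr, hYs⟩ := hY
  obtain ⟨hYhr, hYhs⟩ := hYh
  have hw := wron_eq Y Yh
  have hwY := wron_eq Y Y
  obtain ⟨X, hX⟩ : ∃ X, X = Y.submatrix Sum.inl id := ⟨_, rfl⟩
  obtain ⟨U, hU⟩ : ∃ U, U = Y.submatrix Sum.inr id := ⟨_, rfl⟩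
  obtain ⟨Xh, hXh⟩ : ∃ X, X = Yh.submatrix Sum.inl id := ⟨_, rfl⟩
  obtain ⟨Uh, hUh⟩ : ∃ U, U = Yh.submatrix Sum.inr id := ⟨_, rfl⟩
  have hM : compM Y Yh = Xh - X * pinv X * Xh := by rw [hX, hXh]; rfl
  obtain ⟨M, hMd⟩ : ∃ M, M = compM Y Yh := ⟨_, rfl⟩
  obtain ⟨T, hT⟩ : ∃ T, T = 1 - pinv M * M := ⟨_, rfl⟩
  obtain ⟨W, hW⟩ : ∃ W, W = wron Y Yh := ⟨_, rfl⟩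
  have hD : compD Y Yh = T * Wᵀ * pinv X * Xh * T := by rw [hT, hMd, hX, hXh, hW]; rfl
  rw [← hX, ← hU, ← hXh, ← hUh, ← hW] at hw
  rw [← hX, ← hU] at hwY hYs
  rw [← hXh, ← hUh] at hYhs
  rw [← hMd] at hM
  have hYs' : Uᵀ * X = Xᵀ * U := by simpa [transpose_mul] using hYs.eq
  have hYhs' : Uhᵀ * Xh = Xhᵀ * Uh := by simpa [transpose_mul] using hYhs.eq
  obtain ⟨m1, -, -, m4⟩ := pinv_spec M
  obtain ⟨x1, -, -, -⟩ := pinv_spec X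
  have hTT : Tᵀ = T := by rw [hT, transpose_sub, m4, transpose_one]
  have hMT : M * T = 0 := by
    rw [hT, Matrix.mul_sub, Matrix.mul_one, ← Matrix.mul_assoc, m1, sub_self]
  have hXT : X * pinv X * Xh * T = Xh * T := by
    rw [hM, Matrix.sub_mul] at hMT
    exact (sub_eq_zero.mp hMT).symm
  have hXT' : T * Xhᵀ = T * Xhᵀ * (pinv X)ᵀ * Xᵀ := by
    have := congrArg transpose hXT
    simp only [transpose_mul, hTT] at this
    simpa only [Matrix.mul_assoc] using this.symm
  have hDform : compD Y Yh = T * (Uhᵀ * Xh) * T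
      - T * Xhᵀ * (pinv X)ᵀ * (Xᵀ * U) * pinv X * Xh * T := by
    calc compD Y Yh = T * Uhᵀ * (X * pinv X * Xh * T)
          - (T * Xhᵀ) * U * pinv X * Xh * T := by
          rw [hD, hw, transpose_sub, transpose_mul, transpose_mul, transpose_transpose,
            transpose_transpose]
          simp only [Matrix.mul_sub, Matrix.sub_mul, Matrix.mul_assoc]
      _ = _ := by
          rw [hXT]
          conv_lhs => rw [hXT']
          simp only [Matrix.mul_assoc]
  have hDs : (compD Y Yh)ᵀ = compD Y Yh := by
    rw [hDform, transpose_sub]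
    congr 1
    · rw [transpose_mul, transpose_mul, hTT, hYhs', hYhs.eq, Matrix.mul_assoc T]
    · simp only [transpose_mul, transpose_transpose, hTT]
      rw [hYs']
      simp only [Matrix.mul_assoc]
  have hr1 : (compD Y Yh).rank ≤ (Xh * T).rank := by
    rw [hD, Matrix.mul_assoc _ Xh T]
    exact rank_mul_le_right _ _
  have hr2 : (compD Y Yh).rank ≤ (W * T).rank := by
    have : compD Y Yh = T * Xhᵀ * (pinv X)ᵀ * (W * T) := by
      rw [← hDs, hD]
      simp only [transpose_mul, transpose_transpose, hTT, Matrix.mul_assoc]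
    rw [this]
    exact rank_mul_le_right _ _
  have hk1 : M.rank + (Xh * T).rank ≤ Xh.rank := by
    apply rank_add_rank_le _ _ _ _ hMT
    intro v hv
    rw [hM, sub_mulVec, ← mulVec_mulVec, hv]; simp
  have hk2 : M.rank + (W * T).rank ≤ W.rank := by
    apply rank_add_rank_le _ _ _ _ hMT
    intro v hv
    obtain ⟨c, hc⟩ := lagr Y (by simpa using hYr)
      (by change wron Y Y = 0; rw [hwY, hYs', sub_self]) (Yh *ᵥ v)
      (by rw [mulVec_mulVec]; rw [hW] at hv; exact hv)
    have hc' : Xh *ᵥ v = X *ᵥ c := by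
      ext i
      have := congrFun hc (Sum.inl i)
      rw [hXh, hX]; exact this
    rw [hM, sub_mulVec, ← mulVec_mulVec, hc', mulVec_mulVec, x1, sub_self]
  have hn1 := negInd_le_rank (compD Y Yh)
  have hn2 := negInd_le_rank (-(compD Y Yh))
  have hneg : (-(compD Y Yh)).rank ≤ (compD Y Yh).rank := by
    have := rank_mul_le_right (-1 : Matrix (Fin n) (Fin n) ℝ) (compD Y Yh)
    simpa only [neg_mul, Matrix.one_mul] using this
  have hwid : Xh.rank ≤ n := by simpa using Xh.rank_le_width
  rw [← hXh, ← hW]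
  refine ⟨hDs, ?_, (min_le_left _ _).trans hwid⟩
  unfold compIdx dualCompIdx
  rw [← hMd]
  omega
end
end

section
/- Let W(λ) be a family of 2n×2n symplectic matrices with Ψ(W(λ)) ≥ 0 on [a,b], with block B(λ) the upper-right n×n block of W(λ). Define ρ_{W(a)}(W(λ)) := rank(W(a)−W(λ⁻)) − rank(W(a)−W(λ)), ρ_{W(b)}(W(λ)) := rank(W(b)−W(λ⁻)) − rank(W(b)−W(λ)). Then Σ_{a<ν≤b} ρ_{W(b)}(W(ν)) − Σ_{a<ν≤b} ρ_{W(a)}(W(ν)) = rank(W(b)−W(a)). -/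
open Matrix
noncomputable section

open Classical in
/-- The left-hand limit value of an `ℕ`-valued function at `x`
(defaulting to `f x` if the left limit does not exist). -/
def leftVal (f : ℝ → ℕ) (x : ℝ) : ℕ :=
  if h : ∃ r, ∀ᶠ t in nhdsWithin x (Set.Iio x), f t = r then h.choose else f x

/-- The jump `f(x⁻) − f(x)` at `x`, as an integer. -/
def jmp (f : ℝ → ℕ) (x : ℝ) : ℤ := (leftVal f x : ℤ) - (f x : ℤ)

def qf {m : Type*} [Fintype m] (A : Matrix m m ℝ) (v : m → ℝ) : ℝ := v ⬝ᵥ A *ᵥ v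

def PosDim {V : Type*} [AddCommGroup V] [Module ℝ V] (f : V → ℝ) (k : ℕ) : Prop :=
  ∃ L : (Fin k → ℝ) →ₗ[ℝ] V, ∀ x, x ≠ 0 → 0 < f (L x)

def pidx {V : Type*} [AddCommGroup V] [Module ℝ V] (f : V → ℝ) : ℕ := sSup {k | PosDim f k}

theorem posDim_diag {V ι : Type*} [AddCommGroup V] [Module ℝ V] [Fintype ι]
    (f : V → ℝ) (e : (ι → ℝ) ≃ₗ[ℝ] V) (lam : ι → ℝ)
    (hf : ∀ c, f (e c) = ∑ i, lam i * c i ^ 2) (k : ℕ) :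
    PosDim f k ↔ k ≤ Nat.card {i // 0 < lam i} := by
  classical
  rw [Nat.card_eq_fintype_card]
  constructor
  · rintro ⟨L, hL⟩
    let G : (Fin k → ℝ) →ₗ[ℝ] ({i // 0 < lam i} → ℝ) :=
      (LinearMap.funLeft ℝ ℝ (Subtype.val : {i // 0 < lam i} → ι)) ∘ₗ e.symm.toLinearMap ∘ₗ L
    have hG : Function.Injective G := by
      rw [← LinearMap.ker_eq_bot, LinearMap.ker_eq_bot']
      intro x hx
      by_contra h0
      have h1 := hL x h0
      have h2 := hf (e.symm (L x))
      rw [e.apply_symm_apply] at h2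
      rw [h2] at h1
      refine absurd h1 (not_lt.mpr (Finset.sum_nonpos ?_))
      intro i _
      by_cases hi : 0 < lam i
      · have : e.symm (L x) i = 0 := congrFun hx ⟨i, hi⟩
        simp [this]
      · exact mul_nonpos_of_nonpos_of_nonneg (not_lt.mp hi) (sq_nonneg _)
    have := LinearMap.finrank_le_finrank_of_injective hG
    simpa using this
  · intro hk
    have hk' : Fintype.card (Fin k) ≤ Fintype.card {i // 0 < lam i} := by simpa using hk
    obtain ⟨φ⟩ := Function.Embedding.nonempty_of_card_le hk'
    let ψ : Fin k → ι := fun j => (φ j).1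
    have hψ : Function.Injective ψ := Subtype.val_injective.comp φ.injective
    refine ⟨e.toLinearMap ∘ₗ Function.ExtendByZero.linearMap ℝ ψ, ?_⟩
    intro x hx
    obtain ⟨j, hj⟩ := Function.ne_iff.mp hx
    simp only [LinearMap.comp_apply, LinearEquiv.coe_coe, hf]
    refine Finset.sum_pos' ?_ ⟨ψ j, Finset.mem_univ _, ?_⟩
    · intro i _
      by_cases hi : ∃ j, ψ j = i
      · obtain ⟨j, rfl⟩ := hi
        exact mul_nonneg (φ j).2.le (sq_nonneg _)
      · have : (Function.ExtendByZero.linearMap ℝ ψ) x i = 0 :=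
          Function.extend_apply' _ _ _ hi
        simp [this]
    · have : (Function.ExtendByZero.linearMap ℝ ψ) x (ψ j) = x j :=
        hψ.extend_apply _ _ _
      rw [this]
      have hj' : x j ≠ 0 := hj
      exact mul_pos (φ j).2 (by positivity)

theorem pidx_diag {V ι : Type*} [AddCommGroup V] [Module ℝ V] [Fintype ι]
    (f : V → ℝ) (e : (ι → ℝ) ≃ₗ[ℝ] V) (lam : ι → ℝ)
    (hf : ∀ c, f (e c) = ∑ i, lam i * c i ^ 2) :
    pidx f = Nat.card {i // 0 < lam i} := by
  have : {k | PosDim f k} = Set.Iic (Nat.card {i // 0 < lam i}) := by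
    ext k; exact posDim_diag f e lam hf k
  rw [pidx, this, csSup_Iic]

theorem pidx_equiv {V V' : Type*} [AddCommGroup V] [Module ℝ V] [AddCommGroup V'] [Module ℝ V']
    (f : V → ℝ) (f' : V' → ℝ) (e : V ≃ₗ[ℝ] V') (h : ∀ v, f' (e v) = f v) :
    pidx f = pidx f' := by
  unfold pidx
  congr 1
  ext k
  constructor
  · rintro ⟨L, hL⟩
    exact ⟨e.toLinearMap ∘ₗ L, fun x hx => by simpa [h] using hL x hx⟩
  · rintro ⟨L, hL⟩
    exact ⟨e.symm.toLinearMap ∘ₗ L, fun x hx => by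
      have := h (e.symm (L x))
      simp only [LinearEquiv.apply_symm_apply] at this
      simpa [← this] using hL x hx⟩

theorem exists_diag {m : Type*} [Fintype m] [DecidableEq m] (A : Matrix m m ℝ) (hA : Aᵀ = A) :
    ∃ (e : (m → ℝ) ≃ₗ[ℝ] (m → ℝ)) (lam : m → ℝ),
      (∀ c, qf A (e c) = ∑ i, lam i * c i ^ 2) ∧ A.rank = Nat.card {i // lam i ≠ 0} := by
  have hH : A.IsHermitian := by rw [Matrix.IsHermitian, conjTranspose_eq_transpose_of_trivial, hA]
  let U : Matrix m m ℝ := hH.eigenvectorUnitary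
  have hU1 : Uᵀ * U = 1 := by
    have := (Matrix.mem_unitaryGroup_iff').mp hH.eigenvectorUnitary.2
    rwa [star_eq_conjTranspose, conjTranspose_eq_transpose_of_trivial] at this
  have hU2 : U * Uᵀ = 1 := by rw [mul_eq_one_comm]; exact hU1
  have hs : A = U * diagonal hH.eigenvalues * Uᵀ := by
    have := hH.spectral_theorem
    rw [Unitary.conjStarAlgAut_apply] at this
    rw [star_eq_conjTranspose, conjTranspose_eq_transpose_of_trivial] at this
    exact this
  refine ⟨Matrix.toLin'OfInv hU1 hU2, hH.eigenvalues, ?_, ?_⟩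
  · intro c
    have h1 : qf A (U *ᵥ c) = c ⬝ᵥ (diagonal hH.eigenvalues) *ᵥ c := by
      have h2 : Uᵀ * A * U = diagonal hH.eigenvalues := by
        calc Uᵀ * A * U = Uᵀ * (U * diagonal hH.eigenvalues * Uᵀ) * U :=
              congrArg (fun Z => Uᵀ * Z * U) hs
          _ = (Uᵀ * U) * diagonal hH.eigenvalues * (Uᵀ * U) := by simp only [Matrix.mul_assoc]
          _ = _ := by rw [hU1]; simp
      rw [← h2, qf]
      simp only [← Matrix.mulVec_mulVec]
      rw [Matrix.dotProduct_mulVec c, Matrix.vecMul_transpose]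
    have : (Matrix.toLin'OfInv hU1 hU2) c = U *ᵥ c := rfl
    rw [this, h1]
    simp only [dotProduct, mulVec_diagonal]
    exact Finset.sum_congr rfl fun i _ => by ring
  · rw [hH.rank_eq_card_non_zero_eigs, Nat.card_eq_fintype_card]

theorem rank_eq_pidx {m : Type*} [Fintype m] [DecidableEq m] (A : Matrix m m ℝ) (hA : Aᵀ = A) :
    A.rank = pidx (qf A) + pidx (qf (-A)) := by
  classical
  obtain ⟨e, lam, h1, h2⟩ := exists_diag A hA
  have h3 : ∀ c, qf (-A) (e c) = ∑ i, (-lam i) * c i ^ 2 := by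
    intro c
    simp only [neg_mul, Finset.sum_neg_distrib, ← h1]
    simp [qf, neg_mulVec]
  rw [h2, pidx_diag _ e lam h1, pidx_diag _ e _ h3]
  simp only [Nat.card_eq_fintype_card, Fintype.card_subtype]
  rw [← Finset.card_union_of_disjoint]
  · congr 1
    ext i
    simp only [Finset.mem_filter, Finset.mem_univ, true_and, Finset.mem_union, neg_pos]
    rw [ne_iff_lt_or_gt, or_comm]
  · rw [Finset.disjoint_filter]
    intro i _ h; simp; exact h.le

theorem pidx_mono {m : Type*} [Fintype m] [DecidableEq m] (A B : Matrix m m ℝ) (hB : Bᵀ = B)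
    (h : ∀ v, qf A v ≤ qf B v) : pidx (qf A) ≤ pidx (qf B) := by
  obtain ⟨e, lam, h1, -⟩ := exists_diag B hB
  have hs : {k | PosDim (qf A) k} ⊆ {k | PosDim (qf B) k} := by
    rintro k ⟨L, hL⟩
    exact ⟨L, fun x hx => (hL x hx).trans_le (h _)⟩
  refine csSup_le_csSup ⟨_, fun k hk => (posDim_diag _ e lam h1 k).1 hk⟩ ?_ hs
  exact ⟨0, 0, fun x hx => absurd (Subsingleton.elim x 0) hx⟩

theorem pidx_lsc {m α : Type*} [Fintype m] [DecidableEq m] (l : Filter α) (Y : α → Matrix m m ℝ)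
    (A : Matrix m m ℝ) (hA : Aᵀ = A) (hY : ∀ᶠ t in l, (Y t)ᵀ = Y t)
    (hl : Filter.Tendsto Y l (nhds A)) : ∀ᶠ t in l, pidx (qf A) ≤ pidx (qf (Y t)) := by
  obtain ⟨e, lam, h1, -⟩ := exists_diag A hA
  have hp : PosDim (qf A) (pidx (qf A)) := by
    rw [posDim_diag _ e lam h1, pidx_diag _ e lam h1]
  obtain ⟨L, hL⟩ := hp
  have hc : IsCompact (Metric.sphere (0 : Fin (pidx (qf A)) → ℝ) 1) := isCompact_sphere _ _
  have hLc : Continuous L := LinearMap.continuous_of_finiteDimensional L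
  have key : ∀ᶠ B in nhds A, ∀ x ∈ Metric.sphere (0 : Fin (pidx (qf A)) → ℝ) 1,
      0 < qf B (L x) := by
    apply hc.eventually_forall_of_forall_eventually
    intro x hx
    have hcont : Continuous fun z : Matrix m m ℝ × (Fin (pidx (qf A)) → ℝ) => qf z.1 (L z.2) := by
      unfold qf
      exact (hLc.comp continuous_snd).dotProduct (continuous_fst.matrix_mulVec (hLc.comp continuous_snd))
    have hx0 : x ≠ 0 := by
      rintro rfl
      simp at hx
    exact hcont.continuousAt.eventually (lt_mem_nhds (hL x hx0))
  filter_upwards [hl.eventually key, hY] with t ht hYt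
  obtain ⟨e', lam', h1', -⟩ := exists_diag (Y t) hYt
  refine le_csSup ⟨_, fun k hk => (posDim_diag _ e' lam' h1' k).1 hk⟩ ⟨L, fun x hx => ?_⟩
  have hn : 0 < ‖x‖ := norm_pos_iff.mpr hx
  have := ht (‖x‖⁻¹ • x) (by simp [norm_smul, hn.ne'])
  simp only [qf, map_smul, mulVec_smul, smul_dotProduct, dotProduct_smul, smul_eq_mul] at this
  have h5 : 0 < ‖x‖⁻¹ := by positivity
  exact (mul_pos_iff_of_pos_left h5).1 ((mul_pos_iff_of_pos_left h5).1 this)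

theorem pidx_sum3 {m : Type*} [Fintype m] [DecidableEq m] (A B C : Matrix m m ℝ)
    (hA : Aᵀ = A) (hB : Bᵀ = B) (hC : Cᵀ = C) :
    pidx (fun z : (m → ℝ) × (m → ℝ) × (m → ℝ) => qf A z.1 + qf B z.2.1 + qf C z.2.2)
      = pidx (qf A) + pidx (qf B) + pidx (qf C) := by
  classical
  obtain ⟨e1, l1, h1, -⟩ := exists_diag A hA
  obtain ⟨e2, l2, h2, -⟩ := exists_diag B hB
  obtain ⟨e3, l3, h3, -⟩ := exists_diag C hC
  let E : (m ⊕ (m ⊕ m) → ℝ) ≃ₗ[ℝ] (m → ℝ) × (m → ℝ) × (m → ℝ) :=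
    (LinearEquiv.sumArrowLequivProdArrow m (m ⊕ m) ℝ ℝ).trans
      (e1.prodCongr ((LinearEquiv.sumArrowLequivProdArrow m m ℝ ℝ).trans (e2.prodCongr e3)))
  rw [pidx_diag _ E (Sum.elim l1 (Sum.elim l2 l3)), pidx_diag _ e1 l1 h1, pidx_diag _ e2 l2 h2,
    pidx_diag _ e3 l3 h3]
  · simp only [Nat.card_eq_fintype_card]
    rw [add_assoc, ← Fintype.card_sum, ← Fintype.card_sum]
    refine Fintype.card_congr (Equiv.trans (Equiv.subtypeSum) ?_)
    refine Equiv.sumCongr (Equiv.refl _) ?_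
    exact Equiv.subtypeSum
  · intro c
    have : E c = (e1 (fun i => c (Sum.inl i)), e2 (fun i => c (Sum.inr (Sum.inl i))),
      e3 (fun i => c (Sum.inr (Sum.inr i)))) := rfl
    rw [this]
    simp only [h1, h2, h3, Fintype.sum_sum_type, Sum.elim_inl, Sum.elim_inr]
    ring

theorem leftVal_eq {f : ℝ → ℕ} {x : ℝ} {r : ℕ}
    (h : ∀ᶠ t in nhdsWithin x (Set.Iio x), f t = r) : leftVal f x = r := by
  have hex : ∃ r, ∀ᶠ t in nhdsWithin x (Set.Iio x), f t = r := ⟨r, h⟩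
  unfold leftVal
  rw [dif_pos hex]
  obtain ⟨t, h1, h2⟩ := (hex.choose_spec.and h).exists
  exact h1.symm.trans h2

/-- Interval statement used for the subdivision argument. -/
def IntP (f g : ℝ → ℕ) (s : ℝ → ℤ) (c d : ℝ) : Prop :=
  {x ∈ Set.Ioc c d | jmp f x ≠ 0}.Finite ∧ {x ∈ Set.Ioc c d | jmp g x ≠ 0}.Finite ∧
    (∑ᶠ x ∈ Set.Ioc c d, jmp f x) - (∑ᶠ x ∈ Set.Ioc c d, jmp g x) = s c - s d

theorem IntP.trans {f g : ℝ → ℕ} {s : ℝ → ℤ} {c d e : ℝ} (hcd : c ≤ d) (hde : d ≤ e)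
    (h1 : IntP f g s c d) (h2 : IntP f g s d e) : IntP f g s c e := by
  have hu : Set.Ioc c e = Set.Ioc c d ∪ Set.Ioc d e := (Set.Ioc_union_Ioc_eq_Ioc hcd hde).symm
  have hd : Disjoint (Set.Ioc c d) (Set.Ioc d e) := by
    rw [Set.disjoint_left]
    intro x hx hx'
    exact absurd hx.2 (not_le.mpr hx'.1)
  have key : ∀ φ : ℝ → ℤ, {x ∈ Set.Ioc c d | φ x ≠ 0}.Finite → {x ∈ Set.Ioc d e | φ x ≠ 0}.Finite →
      {x ∈ Set.Ioc c e | φ x ≠ 0}.Finite ∧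
      (∑ᶠ x ∈ Set.Ioc c e, φ x) = (∑ᶠ x ∈ Set.Ioc c d, φ x) + (∑ᶠ x ∈ Set.Ioc d e, φ x) := by
    intro φ k1 k2
    refine ⟨?_, ?_⟩
    · refine (k1.union k2).subset ?_
      rintro x ⟨hx, hx'⟩
      rw [hu] at hx
      rcases hx with hx | hx
      · exact Or.inl ⟨hx, hx'⟩
      · exact Or.inr ⟨hx, hx'⟩
    · rw [hu]
      exact finsum_mem_union' hd k1 k2
  obtain ⟨a1, a2, a3⟩ := h1
  obtain ⟨b1, b2, b3⟩ := h2
  obtain ⟨f1, f2⟩ := key _ a1 b1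
  obtain ⟨g1, g2⟩ := key _ a2 b2
  refine ⟨f1, g1, ?_⟩
  rw [f2, g2]
  linarith

theorem finsum_single_pt (φ : ℝ → ℤ) (x c d : ℝ) (h : ∀ y ∈ Set.Ioc c d, y ≠ x → φ y = 0) :
    {y ∈ Set.Ioc c d | φ y ≠ 0}.Finite ∧
      (x ∈ Set.Ioc c d → ∑ᶠ y ∈ Set.Ioc c d, φ y = φ x) ∧
      (x ∉ Set.Ioc c d → ∑ᶠ y ∈ Set.Ioc c d, φ y = 0) := by
  refine ⟨(Set.finite_singleton x).subset ?_, ?_, ?_⟩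
  · rintro y ⟨hy, hy'⟩
    by_contra hne
    exact hy' (h y hy hne)
  · intro hx
    rw [finsum_eq_single _ x]
    · simp [hx]
    · intro y hy
      by_cases hy' : y ∈ Set.Ioc c d
      · simp [h y hy' hy]
      · have : IsEmpty (y ∈ Set.Ioc c d) := ⟨hy'⟩
        exact finsum_of_isEmpty _
  · intro hx
    apply finsum_mem_of_eqOn_zero
    intro y hy
    exact h y hy (fun h => hx (h ▸ hy))

theorem intP_local {f g : ℝ → ℕ} {s : ℝ → ℤ} {a b x : ℝ} (hx : x ∈ Set.Icc a b)
    (hl : a < x → ∃ r r' : ℕ, ∀ᶠ t in nhdsWithin x (Set.Iio x),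
      f t = r ∧ g t = r' ∧ s t - s x = ((r : ℤ) - f x) - ((r' : ℤ) - g x))
    (hr : x < b → ∃ r r' : ℕ, ∀ᶠ t in nhdsWithin x (Set.Ioi x),
      f t = r ∧ g t = r' ∧ s t = s x) :
    ∃ ε > 0, ∀ c d, c ≤ d → a ≤ c → d ≤ b → x - ε < c → d < x + ε → IntP f g s c d := by
  obtain ⟨ε₁, hε₁, hL⟩ : ∃ ε > 0, a < x → ∃ r r' : ℕ, ∀ t, x - ε < t → t < x →
      f t = r ∧ g t = r' ∧ s t - s x = ((r : ℤ) - f x) - ((r' : ℤ) - g x) := by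
    by_cases h : a < x
    · obtain ⟨r, r', hr⟩ := hl h
      obtain ⟨l, hl, hl'⟩ := (mem_nhdsLT_iff_exists_Ioo_subset).1 hr
      refine ⟨x - l, sub_pos.mpr hl, fun _ => ⟨r, r', fun t h1 h2 => ?_⟩⟩
      exact hl' ⟨by linarith, h2⟩
    · exact ⟨1, one_pos, fun h' => absurd h' h⟩
  obtain ⟨ε₂, hε₂, hR⟩ : ∃ ε > 0, x < b → ∃ r r' : ℕ, ∀ t, x < t → t < x + ε →
      f t = r ∧ g t = r' ∧ s t = s x := by
    by_cases h : x < b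
    · obtain ⟨r, r', hr⟩ := hr h
      obtain ⟨l, hl, hl'⟩ := (mem_nhdsGT_iff_exists_Ioo_subset).1 hr
      refine ⟨l - x, sub_pos.mpr hl, fun _ => ⟨r, r', fun t h1 h2 => ?_⟩⟩
      exact hl' ⟨h1, by linarith⟩
    · exact ⟨1, one_pos, fun h' => absurd h' h⟩
  refine ⟨min ε₁ ε₂, lt_min hε₁ hε₂, ?_⟩
  intro c d hcd hac hdb hc hd
  have hc : x - ε₁ < c := by linarith [min_le_left ε₁ ε₂]
  have hd : d < x + ε₂ := by linarith [min_le_right ε₁ ε₂]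
  have jz : ∀ (φ : ℝ → ℕ) (y u v : ℝ) (r : ℕ), y ∈ Set.Ioo u v →
      (∀ t ∈ Set.Ioo u v, φ t = r) → jmp φ y = 0 := by
    intro φ y u v r hy h
    have : leftVal φ y = r := leftVal_eq (by
      filter_upwards [Ioo_mem_nhdsLT hy.1] with t ht
      exact h t ⟨ht.1, ht.2.trans hy.2⟩)
    rw [jmp, this, h y hy, sub_self]
  have hz : ∀ y ∈ Set.Ioc c d, y ≠ x → jmp f y = 0 ∧ jmp g y = 0 := by
    intro y hy hne
    rcases lt_or_gt_of_ne hne with h | h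
    · obtain ⟨r, r', H⟩ := hL (by linarith [hy.1])
      exact ⟨jz f y (x - ε₁) x r ⟨by linarith [hy.1], h⟩ fun t ht => (H t ht.1 ht.2).1,
        jz g y (x - ε₁) x r' ⟨by linarith [hy.1], h⟩ fun t ht => (H t ht.1 ht.2).2.1⟩
    · obtain ⟨r, r', H⟩ := hR (by linarith [hy.2])
      exact ⟨jz f y x (x + ε₂) r ⟨h, by linarith [hy.2]⟩ fun t ht => (H t ht.1 ht.2).1,
        jz g y x (x + ε₂) r' ⟨h, by linarith [hy.2]⟩ fun t ht => (H t ht.1 ht.2).2.1⟩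
  obtain ⟨f1, f2, f3⟩ := finsum_single_pt (jmp f) x c d fun y hy hn => (hz y hy hn).1
  obtain ⟨g1, g2, g3⟩ := finsum_single_pt (jmp g) x c d fun y hy hn => (hz y hy hn).2
  refine ⟨f1, g1, ?_⟩
  have hsR : ∀ t, t ≤ d → x ≤ t → s t = s x := by
    intro t ht hxt
    rcases hxt.eq_or_lt with rfl | h
    · rfl
    · obtain ⟨r, r', H⟩ := hR (by linarith)
      exact (H t h (by linarith)).2.2
  by_cases hxm : x ∈ Set.Ioc c d
  · rw [f2 hxm, g2 hxm, hsR d le_rfl hxm.2]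
    obtain ⟨r, r', H⟩ := hL (by linarith [hxm.1])
    have e1 : leftVal f x = r := leftVal_eq (by
      filter_upwards [Ioo_mem_nhdsLT (show x - ε₁ < x by linarith)] with t ht
      exact (H t ht.1 ht.2).1)
    have e2 : leftVal g x = r' := leftVal_eq (by
      filter_upwards [Ioo_mem_nhdsLT (show x - ε₁ < x by linarith)] with t ht
      exact (H t ht.1 ht.2).2.1)
    rw [(H c hc hxm.1).2.2, jmp, jmp, e1, e2]
  · rw [f3 hxm, g3 hxm]
    by_cases h : x ≤ c
    · rw [hsR c hcd h, hsR d le_rfl (h.trans hcd), sub_self, sub_self]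
    · push Not at h
      have hdx : d < x := by
        by_contra h'
        exact hxm ⟨h, not_lt.mp h'⟩
      obtain ⟨r, r', H⟩ := hL (by linarith)
      have := (H c hc h).2.2
      have := (H d (by linarith) hdx).2.2
      linarith

theorem intP_global {f g : ℝ → ℕ} {s : ℝ → ℤ} {a b : ℝ} (hab : a ≤ b)
    (hl : ∀ x ∈ Set.Icc a b, a < x → ∃ r r' : ℕ, ∀ᶠ t in nhdsWithin x (Set.Iio x),
      f t = r ∧ g t = r' ∧ s t - s x = ((r : ℤ) - f x) - ((r' : ℤ) - g x))
    (hr : ∀ x ∈ Set.Icc a b, x < b → ∃ r r' : ℕ, ∀ᶠ t in nhdsWithin x (Set.Ioi x),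
      f t = r ∧ g t = r' ∧ s t = s x) : IntP f g s a b := by
  have loc : ∀ x : Set.Icc a b, ∃ ε > 0, ∀ c d, c ≤ d → a ≤ c → d ≤ b → x - ε < c →
      d < x + ε → IntP f g s c d := fun x => intP_local x.2 (hl x x.2) (hr x x.2)
  choose ε hε H using loc
  obtain ⟨t, t0, tm, ⟨m, hm⟩, ht⟩ := exists_monotone_Icc_subset_open_cover_Icc hab
    (c := fun x : Set.Icc a b => {y : Set.Icc a b | (y : ℝ) ∈ Set.Ioo (x - ε x : ℝ) (x + ε x)})
    (fun x => isOpen_Ioo.preimage continuous_subtype_val)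
    (fun x _ => Set.mem_iUnion.2 ⟨x, by simp [hε x]⟩)
  have step : ∀ k, IntP f g s (t k) (t (k + 1)) := by
    intro k
    obtain ⟨i, hi⟩ := ht k
    have hk : t k ≤ t (k + 1) := tm (Nat.le_succ k)
    have h1 := hi (Set.left_mem_Icc.2 hk)
    have h2 := hi (Set.right_mem_Icc.2 hk)
    exact H i _ _ hk (t k).2.1 (t (k + 1)).2.2 h1.1 h2.2
  have all : ∀ k, IntP f g s a (t k) := by
    intro k
    induction k with
    | zero =>
      rw [t0]
      simp [IntP]
    | succ k ih => exact ih.trans (t k).2.1 (tm (Nat.le_succ k)) (step k)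
  have := all m
  rwa [hm m le_rfl] at this

theorem ev_const_left (g : ℝ → ℕ) (c d : ℝ) (hcd : c < d) (h : AntitoneOn g (Set.Ioo c d)) :
    ∃ r, ∀ᶠ t in nhdsWithin d (Set.Iio d), g t = r := by
  have hne : (g '' Set.Ioo c d).Nonempty := (Set.nonempty_Ioo.2 hcd).image g
  obtain ⟨t₀, ht₀, h0⟩ := Nat.sInf_mem hne
  refine ⟨sInf (g '' Set.Ioo c d), ?_⟩
  filter_upwards [Ioo_mem_nhdsLT ht₀.2] with t ht
  have htm : t ∈ Set.Ioo c d := ⟨ht₀.1.trans ht.1, ht.2⟩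
  refine le_antisymm ?_ (Nat.sInf_le ⟨t, htm, rfl⟩)
  rw [← h0]
  exact h ht₀ htm ht.1.le

theorem ev_const_right (g : ℝ → ℕ) (c d : ℝ) (hcd : c < d) (h : MonotoneOn g (Set.Ioo c d)) :
    ∃ r, ∀ᶠ t in nhdsWithin c (Set.Ioi c), g t = r := by
  have hne : (g '' Set.Ioo c d).Nonempty := (Set.nonempty_Ioo.2 hcd).image g
  obtain ⟨t₀, ht₀, h0⟩ := Nat.sInf_mem hne
  refine ⟨sInf (g '' Set.Ioo c d), ?_⟩
  filter_upwards [Ioo_mem_nhdsGT ht₀.1] with t ht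
  have htm : t ∈ Set.Ioo c d := ⟨ht.1, ht.2.trans ht₀.2⟩
  refine le_antisymm ?_ (Nat.sInf_le ⟨t, htm, rfl⟩)
  rw [← h0]
  exact h htm ht₀ ht.2.le

theorem Jmat_transpose (k : Type*) [Fintype k] [DecidableEq k] : (Jmat k)ᵀ = -Jmat k := by
  simp [Jmat, fromBlocks_transpose, fromBlocks_neg]

theorem Jmat_sq (k : Type*) [Fintype k] [DecidableEq k] : Jmat k * Jmat k = -1 := by
  rw [Jmat, fromBlocks_multiply, ← fromBlocks_one, fromBlocks_neg]
  simp

theorem symp_detMat_ne {k : Type*} [Fintype k] [DecidableEq k] (W : Matrix (k ⊕ k) (k ⊕ k) ℝ)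
    (hW : IsSymplectic W) :
    ((5 / 4 : ℂ) • (1 : Matrix (k ⊕ k) (k ⊕ k) ℂ) + Complex.I • (Jmat k).map (algebraMap ℝ ℂ)
      - (3 / 4 : ℂ) • W.map (algebraMap ℝ ℂ)).det ≠ 0 := by
  intro h0
  obtain ⟨v, hv, h1⟩ := Matrix.exists_mulVec_eq_zero_iff.2 h0
  set K : Matrix (k ⊕ k) (k ⊕ k) ℂ := Complex.I • (Jmat k).map (algebraMap ℝ ℂ) with hK
  set V : Matrix (k ⊕ k) (k ⊕ k) ℂ := W.map (algebraMap ℝ ℂ) with hV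
  have hKK : K * K = 1 := by
    rw [hK, smul_mul_smul_comm, Complex.I_mul_I, ← Matrix.map_mul, Jmat_sq]
    ext i j
    by_cases h : i = j <;> simp [Matrix.one_apply, h]
  have hKH : Kᴴ = K := by
    rw [hK, conjTranspose_smul]
    have : ((Jmat k).map (algebraMap ℝ ℂ))ᴴ = -(Jmat k).map (algebraMap ℝ ℂ) := by
      ext i j
      have := congrFun (congrFun (Jmat_transpose k) i) j
      simp only [transpose_apply, neg_apply] at this
      simp [conjTranspose_apply, this]
    rw [this]
    simp
  have hVK : Vᴴ * K * V = K := by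
    have h2 : Vᴴ = (Wᵀ).map (algebraMap ℝ ℂ) := by
      ext i j
      simp [hV, conjTranspose_apply]
    rw [h2, hK, hV, mul_smul_comm, smul_mul_assoc, ← Matrix.map_mul, ← Matrix.map_mul]
    congr 2
  -- the vector identity
  have h3 : (3 / 4 : ℂ) • (V *ᵥ v) = ((5 / 4 : ℂ) • (1 : Matrix (k ⊕ k) (k ⊕ k) ℂ) + K) *ᵥ v := by
    rw [sub_mulVec, sub_eq_zero, smul_mulVec] at h1
    exact h1.symm
  have h4 : star ((3 / 4 : ℂ) • (V *ᵥ v)) ⬝ᵥ K *ᵥ ((3 / 4 : ℂ) • (V *ᵥ v))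
      = (9 / 16 : ℂ) * (star v ⬝ᵥ K *ᵥ v) := by
    conv_rhs => rw [← hVK]
    simp only [star_smul, mulVec_smul, smul_dotProduct, dotProduct_smul, ← mulVec_mulVec, smul_eq_mul]
    rw [star_mulVec, dotProduct_mulVec (star v), ]
    have : star (3 / 4 : ℂ) = 3 / 4 := by simp
    rw [this]; ring
  rw [h3] at h4
  set M : Matrix (k ⊕ k) (k ⊕ k) ℂ := (5 / 4 : ℂ) • (1 : Matrix (k ⊕ k) (k ⊕ k) ℂ) + K with hM
  have hMH : Mᴴ = M := by
    rw [hM, conjTranspose_add, hKH, conjTranspose_smul, conjTranspose_one]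
    simp
  have h5 : star (M *ᵥ v) ⬝ᵥ K *ᵥ (M *ᵥ v) = star v ⬝ᵥ (M * K * M) *ᵥ v := by
    rw [star_mulVec, hMH, ← dotProduct_mulVec, ← mulVec_mulVec, ← mulVec_mulVec]
  have h6 : M * K * M - (9 / 16 : ℂ) • K = (1 / 2 : ℂ) • 1 + (1 + K) * (1 + K) := by
    have e1 : K * K * K = K := by rw [hKK, one_mul]
    rw [hM]
    simp only [add_mul, mul_add, smul_mul_assoc, mul_smul_comm, one_mul, mul_one, hKK, smul_add,
      smul_smul]
    module
  have h7 : star v ⬝ᵥ (M * K * M - (9 / 16 : ℂ) • K) *ᵥ v = 0 := by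
    rw [sub_mulVec, dotProduct_sub, ← h5, h4, smul_mulVec (9 / 16 : ℂ) K v, dotProduct_smul (9 / 16 : ℂ) (star v) (K *ᵥ v),
      smul_eq_mul, sub_self]
  rw [h6, add_mulVec, dotProduct_add, smul_mulVec, dotProduct_smul, one_mulVec, smul_eq_mul] at h7
  have h8 : star v ⬝ᵥ ((1 + K) * (1 + K)) *ᵥ v = star ((1 + K) *ᵥ v) ⬝ᵥ ((1 + K) *ᵥ v) := by
    rw [star_mulVec, conjTranspose_add, hKH, conjTranspose_one, ← dotProduct_mulVec, mulVec_mulVec]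
  rw [h8] at h7
  have key : ∀ w : (k ⊕ k) → ℂ, star w ⬝ᵥ w = ((∑ i, ‖w i‖ ^ 2 : ℝ) : ℂ) := by
    intro w
    simp only [dotProduct, Pi.star_apply, Complex.ofReal_sum]
    refine Finset.sum_congr rfl fun i _ => ?_
    rw [RCLike.star_def, Complex.conj_mul']
    push_cast
    rfl
  rw [key, key] at h7
  have h9 : (1 / 2 : ℝ) * (∑ i, ‖v i‖ ^ 2) + ∑ i, ‖((1 + K) *ᵥ v) i‖ ^ 2 = 0 := by
    have h7' := congrArg Complex.re h7
    rw [Complex.add_re, show (1 / 2 : ℂ) = ((1 / 2 : ℝ) : ℂ) by push_cast; rfl,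
      Complex.re_ofReal_mul, Complex.ofReal_re, Complex.ofReal_re] at h7'
    exact h7'
  have h10 : 0 ≤ ∑ i, ‖((1 + K) *ᵥ v) i‖ ^ 2 := Finset.sum_nonneg fun i _ => sq_nonneg _
  obtain ⟨i, hi⟩ := Function.ne_iff.1 hv
  have hi' : v i ≠ 0 := hi
  have h11 : 0 < ∑ i, ‖v i‖ ^ 2 :=
    Finset.sum_pos' (fun i _ => sq_nonneg _) ⟨i, Finset.mem_univ _, by positivity⟩
  linarith

/-- Characteristic-like polynomial whose zeros are the bad parameters. -/
def badPoly {k : Type*} [Fintype k] [DecidableEq k] (W : Matrix (k ⊕ k) (k ⊕ k) ℝ) :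
    Polynomial ℝ :=
  ((1 - Polynomial.X ^ 2 : Polynomial ℝ) • (1 : Matrix (k ⊕ k) (k ⊕ k) (Polynomial ℝ))
    + (2 * Polynomial.X : Polynomial ℝ) • (Jmat k).map Polynomial.C
    - (1 + Polynomial.X ^ 2 : Polynomial ℝ) • W.map Polynomial.C).det

theorem badPoly_aeval {k A : Type*} [Fintype k] [DecidableEq k] [CommRing A] [Algebra ℝ A]
    (W : Matrix (k ⊕ k) (k ⊕ k) ℝ) (u : A) :
    Polynomial.aeval u (badPoly W) = ((1 - u ^ 2) • (1 : Matrix (k ⊕ k) (k ⊕ k) A)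
      + (2 * u) • (Jmat k).map (algebraMap ℝ A) - (1 + u ^ 2) • W.map (algebraMap ℝ A)).det := by
  rw [badPoly, AlgHom.map_det]
  congr 1
  ext i j
  have h2 : (Polynomial.aeval u) (2 : Polynomial ℝ) = 2 := map_ofNat _ 2
  by_cases h : i = j <;> simp [Matrix.one_apply, h, h2]

theorem badPoly_ne {k : Type*} [Fintype k] [DecidableEq k] (W : Matrix (k ⊕ k) (k ⊕ k) ℝ)
    (hW : IsSymplectic W) : badPoly W ≠ 0 := by
  intro h
  have h1 := badPoly_aeval W (Complex.I / 2)
  rw [h, map_zero] at h1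
  apply symp_detMat_ne W hW
  rw [h1]
  have e : (Complex.I / 2) ^ 2 = -1 / 4 := by rw [div_pow, Complex.I_sq]; norm_num
  rw [e]
  congr 4
  · norm_num
  · ring
  · norm_num

theorem exists_R {k : Type*} [Fintype k] [DecidableEq k] (W1 W2 W3 : Matrix (k ⊕ k) (k ⊕ k) ℝ)
    (h1 : IsSymplectic W1) (h2 : IsSymplectic W2) (h3 : IsSymplectic W3) :
    ∃ R : Matrix (k ⊕ k) (k ⊕ k) ℝ, IsSymplectic R ∧ (R - W1).det ≠ 0 ∧ (R - W2).det ≠ 0 ∧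
      (R - W3).det ≠ 0 := by
  have hp : badPoly W1 * badPoly W2 * badPoly W3 ≠ 0 :=
    mul_ne_zero (mul_ne_zero (badPoly_ne _ h1) (badPoly_ne _ h2)) (badPoly_ne _ h3)
  obtain ⟨u, hu⟩ : ∃ u : ℝ, (badPoly W1 * badPoly W2 * badPoly W3).eval u ≠ 0 := by
    by_contra! h
    exact hp (Polynomial.funext fun u => by simp [h u])
  rw [Polynomial.eval_mul, Polynomial.eval_mul] at hu
  have hpos : (1 + u ^ 2) ≠ 0 := by positivity
  let R : Matrix (k ⊕ k) (k ⊕ k) ℝ := (1 + u ^ 2)⁻¹ • ((1 - u ^ 2) • 1 + (2 * u) • Jmat k)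
  have hR : ∀ W, (badPoly W).eval u ≠ 0 → (R - W).det ≠ 0 := by
    intro W hW h0
    apply hW
    have := badPoly_aeval W u
    rw [Polynomial.coe_aeval_eq_eval] at this
    rw [this]
    have e : ((1 - u ^ 2) • (1 : Matrix (k ⊕ k) (k ⊕ k) ℝ) + (2 * u) • (Jmat k).map (algebraMap ℝ ℝ)
      - (1 + u ^ 2) • W.map (algebraMap ℝ ℝ)) = (1 + u ^ 2) • (R - W) := by
      simp only [R]
      rw [smul_sub, smul_smul, mul_inv_cancel₀ hpos, one_smul]
      rfl
    rw [e, det_smul, h0, mul_zero]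
  refine ⟨R, ?_, hR _ ?_, hR _ ?_, hR _ ?_⟩
  · have e1 : Rᵀ = (1 + u ^ 2)⁻¹ • ((1 - u ^ 2) • 1 - (2 * u) • Jmat k) := by
      simp only [R, transpose_smul, transpose_add, transpose_one, Jmat_transpose]
      module
    rw [IsSymplectic, e1]
    simp only [R, smul_mul_assoc, mul_smul_comm, add_mul, mul_add, sub_mul, one_mul, mul_one, Jmat_sq,
      neg_mul, mul_sub, smul_smul, smul_add, smul_sub, smul_neg, Matrix.mul_assoc, mul_neg]
    match_scalars <;> field_simp <;> ring
  · exact fun h => hu (by rw [h]; simp)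
  · exact fun h => hu (by rw [h]; simp)
  · exact fun h => hu (by rw [h]; simp)

section chart

variable {k : Type*} [Fintype k] [DecidableEq k]

/-- Chart factor. -/
def Nm (R W : Matrix (k ⊕ k) (k ⊕ k) ℝ) : Matrix (k ⊕ k) (k ⊕ k) ℝ := (R - W)⁻¹ * R

/-- Symmetric (up to a constant) chart matrix. -/
def Xm (R W : Matrix (k ⊕ k) (k ⊕ k) ℝ) : Matrix (k ⊕ k) (k ⊕ k) ℝ := Jmat k * Nm R W

/-- Kashiwara coefficient. -/
def Km (W1 W2 : Matrix (k ⊕ k) (k ⊕ k) ℝ) : Matrix (k ⊕ k) (k ⊕ k) ℝ :=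
  W1ᵀ * Jmat k * W2 - Jmat k

theorem symp_det {W : Matrix (k ⊕ k) (k ⊕ k) ℝ} (hW : IsSymplectic W) : IsUnit W.det := by
  have h : Jmat k * (-Jmat k) = 1 := by rw [mul_neg, Jmat_sq, neg_neg]
  have hJ : (-Jmat k * Wᵀ * Jmat k) * W = 1 := by
    have : Wᵀ * Jmat k * W = Jmat k := hW
    rw [Matrix.mul_assoc, Matrix.mul_assoc, ← Matrix.mul_assoc Wᵀ, this, mul_eq_one_comm, h]
  exact isUnit_det_of_left_inverse hJ

theorem J_det : IsUnit (Jmat k).det := by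
  have h : Jmat k * (-Jmat k) = 1 := by rw [mul_neg, Jmat_sq, neg_neg]
  exact isUnit_det_of_right_inverse h

theorem WN {R W : Matrix (k ⊕ k) (k ⊕ k) ℝ} (h : (R - W).det ≠ 0) :
    W * Nm R W = R * (Nm R W - 1) := by
  have h1 : (R - W) * Nm R W = R := by
    rw [Nm, ← Matrix.mul_assoc, mul_nonsing_inv _ (isUnit_iff_ne_zero.2 h), one_mul]
  rw [sub_mul] at h1
  rw [mul_sub, mul_one]
  exact (sub_eq_of_eq_add (by rw [add_comm]; exact eq_add_of_sub_eq h1)).symm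

theorem N_det {R W : Matrix (k ⊕ k) (k ⊕ k) ℝ} (hR : IsSymplectic R) (h : (R - W).det ≠ 0) :
    IsUnit (Nm R W).det := by
  rw [Nm, det_mul]
  exact ((isUnit_nonsing_inv_det _ (isUnit_iff_ne_zero.2 h))).mul (symp_det hR)

theorem NKN' {R W1 W2 : Matrix (k ⊕ k) (k ⊕ k) ℝ} (hR : IsSymplectic R)
    (h1 : (R - W1).det ≠ 0) (h2 : (R - W2).det ≠ 0) :
    (Nm R W1)ᵀ * Km W1 W2 * Nm R W2 = (Xm R W1)ᵀ - Xm R W2 + Jmat k := by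
  have e : (Nm R W1)ᵀ * Km W1 W2 * Nm R W2 =
      (W1 * Nm R W1)ᵀ * Jmat k * (W2 * Nm R W2) - (Nm R W1)ᵀ * Jmat k * Nm R W2 := by
    simp only [Km, mul_sub, sub_mul, transpose_mul, Matrix.mul_assoc]
  have hR' : Rᵀ * (Jmat k * R) = Jmat k := by rw [← Matrix.mul_assoc]; exact hR
  rw [e, WN h1, WN h2]
  have e2 : (R * (Nm R W1 - 1))ᵀ * Jmat k * (R * (Nm R W2 - 1)) =
      (Nm R W1 - 1)ᵀ * Jmat k * (Nm R W2 - 1) := by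
    rw [transpose_mul]
    calc (Nm R W1 - 1)ᵀ * Rᵀ * Jmat k * (R * (Nm R W2 - 1))
      = (Nm R W1 - 1)ᵀ * (Rᵀ * (Jmat k * R)) * (Nm R W2 - 1) := by simp only [Matrix.mul_assoc]
      _ = _ := by rw [hR']
  rw [e2]
  simp only [Xm, transpose_mul, transpose_sub, transpose_one, Jmat_transpose, sub_mul, mul_sub,
    one_mul, mul_one, mul_neg]
  abel

theorem X_symm {R W : Matrix (k ⊕ k) (k ⊕ k) ℝ} (hR : IsSymplectic R) (hW : IsSymplectic W)
    (h : (R - W).det ≠ 0) : (Xm R W)ᵀ = Xm R W - Jmat k := by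
  have h1 := NKN' hR h h
  have h2 : Km W W = 0 := by rw [Km, sub_eq_zero]; exact hW
  rw [h2, mul_zero, zero_mul] at h1
  have : (Xm R W)ᵀ = ((Xm R W)ᵀ - Xm R W + Jmat k) + (Xm R W - Jmat k) := by abel
  rw [this, ← h1, zero_add]

theorem NKN {R W1 W2 : Matrix (k ⊕ k) (k ⊕ k) ℝ} (hR : IsSymplectic R) (hW1 : IsSymplectic W1)
    (h1 : (R - W1).det ≠ 0) (h2 : (R - W2).det ≠ 0) :
    (Nm R W1)ᵀ * Km W1 W2 * Nm R W2 = Xm R W1 - Xm R W2 := by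
  rw [NKN' hR h1 h2, X_symm hR hW1 h1]
  abel

theorem Xdiff_symm {R W1 W2 : Matrix (k ⊕ k) (k ⊕ k) ℝ} (hR : IsSymplectic R)
    (hW1 : IsSymplectic W1) (hW2 : IsSymplectic W2)
    (h1 : (R - W1).det ≠ 0) (h2 : (R - W2).det ≠ 0) :
    (Xm R W1 - Xm R W2)ᵀ = Xm R W1 - Xm R W2 := by
  rw [transpose_sub, X_symm hR hW1 h1, X_symm hR hW2 h2]
  abel

theorem Km_eq {W1 W2 : Matrix (k ⊕ k) (k ⊕ k) ℝ} (hW2 : IsSymplectic W2) :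
    Km W1 W2 = (W1 - W2)ᵀ * Jmat k * W2 := by
  rw [transpose_sub, sub_mul, sub_mul]
  have : W2ᵀ * Jmat k * W2 = Jmat k := hW2
  rw [this, Km]

theorem X_rank {R W1 W2 : Matrix (k ⊕ k) (k ⊕ k) ℝ} (hR : IsSymplectic R)
    (hW1 : IsSymplectic W1) (hW2 : IsSymplectic W2)
    (h1 : (R - W1).det ≠ 0) (h2 : (R - W2).det ≠ 0) :
    (Xm R W1 - Xm R W2).rank = (W1 - W2).rank := by
  rw [← NKN hR hW1 h1 h2, Km_eq hW2, rank_mul_eq_left_of_isUnit_det _ _ (N_det hR h2),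
    rank_mul_eq_right_of_isUnit_det _ _ (by rw [det_transpose]; exact N_det hR h1),
    rank_mul_eq_left_of_isUnit_det _ _ (symp_det hW2), rank_mul_eq_left_of_isUnit_det _ _ J_det,
    rank_transpose]

/-- The Kashiwara form. -/
def kash (W1 W2 W3 : Matrix (k ⊕ k) (k ⊕ k) ℝ)
    (z : ((k ⊕ k) → ℝ) × ((k ⊕ k) → ℝ) × ((k ⊕ k) → ℝ)) : ℝ :=
  z.1 ⬝ᵥ Km W1 W2 *ᵥ z.2.1 + z.2.1 ⬝ᵥ Km W2 W3 *ᵥ z.2.2 + z.2.2 ⬝ᵥ Km W3 W1 *ᵥ z.1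

theorem kash_change {m : Type*} [Fintype m] (A B C : Matrix m m ℝ)
    (hAB : (A - B)ᵀ = A - B) (hBC : (B - C)ᵀ = B - C) (hCA : (C - A)ᵀ = C - A)
    (p q r : m → ℝ) :
    (q + r) ⬝ᵥ (A - B) *ᵥ (p + r) + (p + r) ⬝ᵥ (B - C) *ᵥ (p + q) + (p + q) ⬝ᵥ (C - A) *ᵥ (q + r)
      = qf (A - B) r + qf (B - C) p + qf (C - A) q := by
  have sym : ∀ M : Matrix m m ℝ, Mᵀ = M → ∀ x y : m → ℝ, x ⬝ᵥ M *ᵥ y = y ⬝ᵥ M *ᵥ x := by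
    intro M hM x y
    rw [dotProduct_mulVec, ← mulVec_transpose, hM, dotProduct_comm]
  have s1 := sym _ hAB
  have s2 := sym _ hBC
  have s3 := sym _ hCA
  have z : ∀ x y : m → ℝ, x ⬝ᵥ (A - B) *ᵥ y + x ⬝ᵥ (B - C) *ᵥ y + x ⬝ᵥ (C - A) *ᵥ y = 0 := by
    intro x y
    simp only [sub_mulVec, dotProduct_sub]
    ring
  simp only [qf, mulVec_add, dotProduct_add, add_dotProduct]
  linarith [z p q, z p r, z r q, s1 r q, s2 r q, s3 r q, s2 q p, s1 q p, s3 q p, s1 r p, s2 r p,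
    s3 r p]

theorem kash_pidx {R W1 W2 W3 : Matrix (k ⊕ k) (k ⊕ k) ℝ} (hR : IsSymplectic R)
    (hW1 : IsSymplectic W1) (hW2 : IsSymplectic W2) (hW3 : IsSymplectic W3)
    (h1 : (R - W1).det ≠ 0) (h2 : (R - W2).det ≠ 0) (h3 : (R - W3).det ≠ 0) :
    pidx (kash W1 W2 W3) = pidx (qf (Xm R W1 - Xm R W2)) + pidx (qf (Xm R W2 - Xm R W3))
      + pidx (qf (Xm R W3 - Xm R W1)) := by
  rw [← pidx_sum3 _ _ _ (Xdiff_symm hR hW1 hW2 h1 h2) (Xdiff_symm hR hW2 hW3 h2 h3)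
    (Xdiff_symm hR hW3 hW1 h3 h1)]
  symm
  -- `(r, p, q) ↦ (N₁ (q + r), N₂ (p + r), N₃ (p + q))`
  have inv : ∀ W, (R - W).det ≠ 0 → ∃ e : ((k ⊕ k) → ℝ) ≃ₗ[ℝ] ((k ⊕ k) → ℝ),
      ∀ v, e v = Nm R W *ᵥ v := fun W h =>
    ⟨toLin'OfInv (nonsing_inv_mul _ (N_det hR h)) (mul_nonsing_inv _ (N_det hR h)), fun v => rfl⟩
  obtain ⟨e1, he1⟩ := inv W1 h1
  obtain ⟨e2, he2⟩ := inv W2 h2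
  obtain ⟨e3, he3⟩ := inv W3 h3
  let S : (((k ⊕ k) → ℝ) × ((k ⊕ k) → ℝ) × ((k ⊕ k) → ℝ)) ≃ₗ[ℝ]
      (((k ⊕ k) → ℝ) × ((k ⊕ k) → ℝ) × ((k ⊕ k) → ℝ)) :=
    { toFun := fun z => (z.2.2 + z.1, z.2.1 + z.1, z.2.1 + z.2.2)
      map_add' := fun x y => by
        refine Prod.ext ?_ (Prod.ext ?_ ?_) <;> simp <;> abel
      map_smul' := fun c x => by
        refine Prod.ext ?_ (Prod.ext ?_ ?_) <;> simp
      invFun := fun z => ((1 / 2 : ℝ) • (z.1 + z.2.1 - z.2.2), (1 / 2 : ℝ) • (z.2.1 + z.2.2 - z.1),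
        (1 / 2 : ℝ) • (z.1 + z.2.2 - z.2.1))
      left_inv := fun z => by
        refine Prod.ext ?_ (Prod.ext ?_ ?_) <;> simp only <;> module
      right_inv := fun z => by
        refine Prod.ext ?_ (Prod.ext ?_ ?_) <;> simp only <;> module }
  refine pidx_equiv _ _ (S.trans (e1.prodCongr (e2.prodCongr e3))) ?_
  rintro ⟨r, p, q⟩
  have hS : (S.trans (e1.prodCongr (e2.prodCongr e3))) (r, p, q)
      = (Nm R W1 *ᵥ (q + r), Nm R W2 *ᵥ (p + r), Nm R W3 *ᵥ (p + q)) := by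
    rw [← he1, ← he2, ← he3]; rfl
  rw [hS]
  have conv : ∀ (N K N' : Matrix (k ⊕ k) (k ⊕ k) ℝ) (x y : (k ⊕ k) → ℝ),
      (N *ᵥ x) ⬝ᵥ K *ᵥ (N' *ᵥ y) = x ⬝ᵥ (Nᵀ * K * N') *ᵥ y := by
    intro N K N' x y
    rw [← mulVec_mulVec, ← mulVec_mulVec, dotProduct_mulVec x, vecMul_transpose]
  simp only [kash, conv, NKN hR hW1 h1 h2, NKN hR hW2 h2 h3, NKN hR hW3 h3 h1]
  exact kash_change _ _ _ (Xdiff_symm hR hW1 hW2 h1 h2) (Xdiff_symm hR hW2 hW3 h2 h3)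
    (Xdiff_symm hR hW3 hW1 h3 h1) p q r

end chart

theorem local_left {m : Type*} [Fintype m] [DecidableEq m] (X : ℝ → Matrix m m ℝ)
    (C : Matrix m m ℝ) (c x : ℝ) (hcx : c < x)
    (hs : ∀ t ∈ Set.Ioc c x, (X t - C)ᵀ = X t - C)
    (hm : ∀ s ∈ Set.Ioc c x, ∀ t ∈ Set.Ioc c x, s ≤ t → ∀ v, qf (X s) v ≤ qf (X t) v)
    (hX : Filter.Tendsto X (nhdsWithin x (Set.Iio x)) (nhds (X x))) :
    (∀ᶠ t in nhdsWithin x (Set.Iio x), pidx (qf (X t - C)) = pidx (qf (X x - C))) ∧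
    ∃ r, ∀ᶠ t in nhdsWithin x (Set.Iio x), pidx (qf (C - X t)) = r := by
  have hs' : ∀ t ∈ Set.Ioc c x, (C - X t)ᵀ = C - X t := by
    intro t ht
    rw [← neg_sub, transpose_neg, hs t ht]
  have hx : x ∈ Set.Ioc c x := ⟨hcx, le_rfl⟩
  constructor
  · have h1 := pidx_lsc (nhdsWithin x (Set.Iio x)) (fun t => X t - C) (X x - C) (hs x hx)
      (by filter_upwards [Ioo_mem_nhdsLT hcx] with t ht using hs t ⟨ht.1, ht.2.le⟩)
      (hX.sub_const C)
    filter_upwards [h1, Ioo_mem_nhdsLT hcx] with t ht ht'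
    refine le_antisymm (pidx_mono _ _ (hs x hx) fun v => ?_) ht
    have := hm t ⟨ht'.1, ht'.2.le⟩ x hx ht'.2.le v
    simp only [qf, sub_mulVec, dotProduct_sub] at this ⊢
    linarith
  · refine ev_const_left _ c x hcx ?_
    intro s h1 t h2 hst
    refine pidx_mono _ _ (hs' s ⟨h1.1, h1.2.le⟩) fun v => ?_
    have := hm s ⟨h1.1, h1.2.le⟩ t ⟨h2.1, h2.2.le⟩ hst v
    simp only [qf, sub_mulVec, dotProduct_sub] at this ⊢
    linarith

theorem local_right {m : Type*} [Fintype m] [DecidableEq m] (X : ℝ → Matrix m m ℝ)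
    (C : Matrix m m ℝ) (d x : ℝ) (hxd : x < d)
    (hs : ∀ t ∈ Set.Ico x d, (X t - C)ᵀ = X t - C)
    (hm : ∀ s ∈ Set.Ico x d, ∀ t ∈ Set.Ico x d, s ≤ t → ∀ v, qf (X s) v ≤ qf (X t) v)
    (hX : Filter.Tendsto X (nhdsWithin x (Set.Ioi x)) (nhds (X x))) :
    (∀ᶠ t in nhdsWithin x (Set.Ioi x), pidx (qf (C - X t)) = pidx (qf (C - X x))) ∧
    ∃ r, ∀ᶠ t in nhdsWithin x (Set.Ioi x), pidx (qf (X t - C)) = r := by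
  have hs' : ∀ t ∈ Set.Ico x d, (C - X t)ᵀ = C - X t := by
    intro t ht
    rw [← neg_sub, transpose_neg, hs t ht]
  have hx : x ∈ Set.Ico x d := ⟨le_rfl, hxd⟩
  constructor
  · have h1 := pidx_lsc (nhdsWithin x (Set.Ioi x)) (fun t => C - X t) (C - X x) (hs' x hx)
      (by filter_upwards [Ioo_mem_nhdsGT hxd] with t ht using hs' t ⟨ht.1.le, ht.2⟩)
      (hX.const_sub C)
    filter_upwards [h1, Ioo_mem_nhdsGT hxd] with t ht ht'
    refine le_antisymm (pidx_mono _ _ (hs' x hx) fun v => ?_) ht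
    have := hm x hx t ⟨ht'.1.le, ht'.2⟩ ht'.1.le v
    simp only [qf, sub_mulVec, dotProduct_sub] at this ⊢
    linarith
  · refine ev_const_right _ x d hxd ?_
    intro s h1 t h2 hst
    refine pidx_mono _ _ (hs t ⟨h2.1.le, h2.2⟩) fun v => ?_
    have := hm s ⟨h1.1.le, h1.2⟩ t ⟨h2.1.le, h2.2⟩ hst v
    simp only [qf, sub_mulVec, dotProduct_sub] at this ⊢
    linarith

section curve

variable {k : Type*} [Fintype k] [DecidableEq k]

theorem tendsto_Nm {α : Type*} {l : Filter α} {W : α → Matrix (k ⊕ k) (k ⊕ k) ℝ}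
    {R V : Matrix (k ⊕ k) (k ⊕ k) ℝ} (hW : Filter.Tendsto W l (nhds V)) (h : (R - V).det ≠ 0) :
    Filter.Tendsto (fun t => Nm R (W t)) l (nhds (Nm R V)) := by
  have hc : ContinuousAt (fun Z : Matrix (k ⊕ k) (k ⊕ k) ℝ => Nm R Z) V := by
    unfold Nm
    simp only [Matrix.inv_def, Ring.inverse_eq_inv']
    have h1 : Continuous fun Z : Matrix (k ⊕ k) (k ⊕ k) ℝ => R - Z := continuous_const.sub continuous_id
    have h2 : ContinuousAt (fun Z : Matrix (k ⊕ k) (k ⊕ k) ℝ => ((R - Z).det)⁻¹) V :=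
      (h1.matrix_det.continuousAt).inv₀ h
    have h3 : ContinuousAt (fun Z : Matrix (k ⊕ k) (k ⊕ k) ℝ => ((R - Z).det)⁻¹ • (R - Z).adjugate) V :=
      h2.smul h1.matrix_adjugate.continuousAt
    exact h3.mul continuousAt_const
  exact hc.tendsto.comp hW

theorem tendsto_Xm {α : Type*} {l : Filter α} {W : α → Matrix (k ⊕ k) (k ⊕ k) ℝ}
    {R V : Matrix (k ⊕ k) (k ⊕ k) ℝ} (hW : Filter.Tendsto W l (nhds V)) (h : (R - V).det ≠ 0) :
    Filter.Tendsto (fun t => Xm R (W t)) l (nhds (Xm R V)) :=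
  (tendsto_Nm hW h).const_mul _

theorem X_deriv {W : ℝ → Matrix (k ⊕ k) (k ⊕ k) ℝ} {V' R : Matrix (k ⊕ k) (k ⊕ k) ℝ} {D : Set ℝ}
    {x : ℝ} (hx : x ∈ D) (hR : IsSymplectic R) (hW : ∀ t ∈ D, IsSymplectic (W t))
    (hdet : ∀ t ∈ D, (R - W t).det ≠ 0)
    (hd : ∀ i j, HasDerivWithinAt (fun t => W t i j) (V' i j) D x) (v : (k ⊕ k) → ℝ) :
    HasDerivWithinAt (fun t => qf (Xm R (W t)) v)
      (qf ((Nm R (W x))ᵀ * (V'ᵀ * Jmat k * W x) * Nm R (W x)) v) D x := by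
  have hWt : Filter.Tendsto W (nhdsWithin x (D \ {x})) (nhds (W x)) := by
    refine tendsto_pi_nhds.2 fun i => tendsto_pi_nhds.2 fun j => ?_
    exact (hd i j).continuousWithinAt.tendsto.mono_left (nhdsWithin_mono _ Set.diff_subset)
  have hsl : Filter.Tendsto (fun t => (t - x)⁻¹ • (W t - W x)) (nhdsWithin x (D \ {x})) (nhds V') := by
    refine tendsto_pi_nhds.2 fun i => tendsto_pi_nhds.2 fun j => ?_
    have := hasDerivWithinAt_iff_tendsto_slope.1 (hd i j)
    exact this
  rw [hasDerivWithinAt_iff_tendsto_slope]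
  have hN := tendsto_Nm hWt (hdet x hx)
  have hcont : Continuous fun z : Matrix (k ⊕ k) (k ⊕ k) ℝ × Matrix (k ⊕ k) (k ⊕ k) ℝ =>
      qf (z.1ᵀ * (z.2ᵀ * Jmat k * W x) * Nm R (W x)) v := by
    unfold qf
    fun_prop
  have lim := (hcont.tendsto (Nm R (W x), V')).comp (hN.prodMk_nhds hsl)
  refine lim.congr' ?_
  filter_upwards [self_mem_nhdsWithin] with t ht
  have e := NKN hR (hW t ht.1) (hdet t ht.1) (hdet x hx)
  rw [Km_eq (hW x hx)] at e
  have e2 : qf (Xm R (W t)) v - qf (Xm R (W x)) v =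
      qf ((Nm R (W t))ᵀ * ((W t - W x)ᵀ * Jmat k * W x) * Nm R (W x)) v := by
    rw [e]
    simp [qf, sub_mulVec, dotProduct_sub]
  rw [slope_def_module, e2]
  simp only [Function.comp, qf, transpose_smul, smul_mul_assoc, mul_smul_comm, smul_mulVec,
    dotProduct_smul]

theorem X_mono {W W' : ℝ → Matrix (k ⊕ k) (k ⊕ k) ℝ} {R : Matrix (k ⊕ k) (k ⊕ k) ℝ} {D : Set ℝ}
    (hD : Convex ℝ D) (hR : IsSymplectic R) (hW : ∀ t ∈ D, IsSymplectic (W t))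
    (hdet : ∀ t ∈ D, (R - W t).det ≠ 0)
    (hd : ∀ x ∈ D, ∀ i j, HasDerivWithinAt (fun t => W t i j) (W' x i j) D x)
    (hmon : ∀ l ∈ D, ((Jmat k)ᵀ * W' l * (W l)⁻¹).PosSemidef) (v : (k ⊕ k) → ℝ) :
    MonotoneOn (fun t => qf (Xm R (W t)) v) D := by
  have key := fun x (hx : x ∈ D) => X_deriv (V' := W' x) hx hR hW hdet (hd x hx) v
  refine monotoneOn_of_hasDerivWithinAt_nonneg hD
    (fun x hx => (key x hx).continuousWithinAt)
    (fun x hx => (key x (interior_subset hx)).mono interior_subset) ?_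
  intro x hx
  have hx := interior_subset hx
  have hp := (hmon x hx).dotProduct_mulVec_nonneg ((W x * Nm R (W x)) *ᵥ v)
  have hinv : W x * (W x)⁻¹ = 1 := mul_nonsing_inv _ (symp_det (hW x hx))
  set P := (Jmat k)ᵀ * W' x * (W x)⁻¹ with hP
  have e : (Nm R (W x))ᵀ * ((W' x)ᵀ * Jmat k * W x) * Nm R (W x)
      = ((W x * Nm R (W x))ᵀ * P * (W x * Nm R (W x)))ᵀ := by
    have h1 : P * W x = (Jmat k)ᵀ * W' x := by
      rw [hP, Matrix.mul_assoc, nonsing_inv_mul _ (symp_det (hW x hx)), mul_one]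
    rw [Matrix.mul_assoc _ P, ← Matrix.mul_assoc P, h1]
    simp only [transpose_mul, transpose_transpose, Matrix.mul_assoc]
  have ht : ∀ M : Matrix (k ⊕ k) (k ⊕ k) ℝ, qf Mᵀ v = qf M v := by
    intro M
    rw [qf, qf, mulVec_transpose, dotProduct_comm, ← dotProduct_mulVec]
  rw [e, ht, qf, ← mulVec_mulVec, ← mulVec_mulVec, dotProduct_mulVec v, vecMul_transpose]
  simpa using hp

end curve

theorem local_data (n : ℕ) (a b : ℝ) (hab : a ≤ b)
    (W W' : ℝ → Matrix (Fin n ⊕ Fin n) (Fin n ⊕ Fin n) ℝ)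
    (hW : ∀ l ∈ Set.Icc a b, IsSymplectic (W l))
    (hd : ∀ l ∈ Set.Icc a b, ∀ i j,
      HasDerivWithinAt (fun t => W t i j) (W' l i j) (Set.Icc a b) l)
    (hmon : ∀ l ∈ Set.Icc a b, ((Jmat (Fin n))ᵀ * W' l * (W l)⁻¹).PosSemidef)
    (f g : ℝ → ℕ) (s : ℝ → ℤ) (hf : f = fun t => (W b - W t).rank)
    (hg : g = fun t => (W a - W t).rank)
    (hs : s = fun t => ((W b - W t).rank : ℤ) - (pidx (kash (W t) (W b) (W a)) : ℤ))
    (x : ℝ) (hx : x ∈ Set.Icc a b) :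
    (a < x → ∃ r r' : ℕ, ∀ᶠ t in nhdsWithin x (Set.Iio x),
      f t = r ∧ g t = r' ∧ s t - s x = ((r : ℤ) - f x) - ((r' : ℤ) - g x)) ∧
    (x < b → ∃ r r' : ℕ, ∀ᶠ t in nhdsWithin x (Set.Ioi x),
      f t = r ∧ g t = r' ∧ s t = s x) := by
  have ha : a ∈ Set.Icc a b := ⟨le_rfl, hab⟩
  have hb : b ∈ Set.Icc a b := ⟨hab, le_rfl⟩
  obtain ⟨R, hR, hRa, hRb, hRx⟩ := exists_R (W a) (W b) (W x) (hW a ha) (hW b hb) (hW x hx)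
  have hWc : Filter.Tendsto W (nhdsWithin x (Set.Icc a b)) (nhds (W x)) := by
    refine tendsto_pi_nhds.2 fun i => tendsto_pi_nhds.2 fun j => ?_
    exact (hd x hx i j).continuousWithinAt.tendsto
  have hXc := tendsto_Xm hWc hRx
  have hdc : Continuous fun Z : Matrix (Fin n ⊕ Fin n) (Fin n ⊕ Fin n) ℝ => (R - Z).det :=
    (continuous_const.sub continuous_id).matrix_det
  have hev : ∀ᶠ t in nhdsWithin x (Set.Icc a b), (R - W t).det ≠ 0 :=
    ((hdc.tendsto (W x)).comp hWc).eventually_ne hRx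
  obtain ⟨δ, hδ, hD⟩ := Metric.mem_nhdsWithin_iff.1 hev
  rw [Real.ball_eq_Ioo] at hD
  set D := Set.Ioo (x - δ) (x + δ) ∩ Set.Icc a b with hDdef
  have hDI : D ⊆ Set.Icc a b := Set.inter_subset_right
  have hdet : ∀ t ∈ D, (R - W t).det ≠ 0 := fun t ht => hD ht
  have hxD : x ∈ D := ⟨⟨by linarith, by linarith⟩, hx⟩
  have mono := X_mono (W := W) (W' := W') (R := R) (D := D)
    ((convex_Ioo _ _).inter (convex_Icc _ _)) hR (fun t ht => hW t (hDI ht)) hdet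
    (fun y hy i j => (hd y (hDI hy) i j).mono hDI) (fun y hy => hmon y (hDI hy))
  let X := fun t => Xm R (W t)
  -- values on `D`
  have rk : ∀ c ∈ Set.Icc a b, (R - W c).det ≠ 0 → ∀ t ∈ D,
      (W c - W t).rank = pidx (qf (X c - X t)) + pidx (qf (X t - X c)) := by
    intro c hc hRc t ht
    rw [← X_rank hR (hW c hc) (hW t (hDI ht)) hRc (hdet t ht),
      rank_eq_pidx _ (Xdiff_symm hR (hW c hc) (hW t (hDI ht)) hRc (hdet t ht)), neg_sub]
  have sy : ∀ c ∈ Set.Icc a b, (R - W c).det ≠ 0 → ∀ t ∈ D, (X t - X c)ᵀ = X t - X c :=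
    fun c hc hRc t ht => Xdiff_symm hR (hW t (hDI ht)) (hW c hc) (hdet t ht) hRc
  have rf : ∀ t ∈ D, f t = pidx (qf (X b - X t)) + pidx (qf (X t - X b)) := by
    rw [hf]; exact rk b hb hRb
  have rg : ∀ t ∈ D, g t = pidx (qf (X a - X t)) + pidx (qf (X t - X a)) := by
    rw [hg]; exact rk a ha hRa
  have rs : ∀ t ∈ D, s t = (pidx (qf (X b - X t)) : ℤ) - pidx (qf (X b - X a))
      - pidx (qf (X a - X t)) := by
    intro t ht
    have h1 := rk b hb hRb t ht
    have h2 := kash_pidx hR (hW t (hDI ht)) (hW b hb) (hW a ha) (hdet t ht) hRb hRa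
    rw [hs]
    simp only
    rw [h1, h2]
    push_cast
    simp only [X]
    ring
  constructor
  · intro hax
    have hcx : max a (x - δ) < x := max_lt hax (by linarith)
    have hsub : Set.Ioc (max a (x - δ)) x ⊆ D := by
      intro t ht
      have h1 := (le_max_left a (x - δ)).trans_lt ht.1
      have h2 := (le_max_right a (x - δ)).trans_lt ht.1
      exact ⟨⟨h2, by linarith [ht.2]⟩, ⟨h1.le, ht.2.trans hx.2⟩⟩
    have hfil : nhdsWithin x (Set.Iio x) ≤ nhdsWithin x (Set.Icc a b) := by
      rw [← nhdsWithin_Ioo_eq_nhdsLT hcx]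
      exact nhdsWithin_mono _ fun t ht => hDI (hsub ⟨ht.1, ht.2.le⟩)
    have L := fun c hc hRc => local_left X (X c) _ x hcx (fun t ht => sy c hc hRc t (hsub ht))
      (fun s h1 t h2 hst v => mono v (hsub h1) (hsub h2) hst) (hXc.mono_left hfil)
    obtain ⟨pb, Qb, qb⟩ := L b hb hRb
    obtain ⟨pa, Qa, qa⟩ := L a ha hRa
    refine ⟨Qb + pidx (qf (X x - X b)), Qa + pidx (qf (X x - X a)), ?_⟩
    filter_upwards [pb, qb, pa, qa, Ioo_mem_nhdsLT hcx] with t h1 h2 h3 h4 ht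
    have htD := hsub ⟨ht.1, ht.2.le⟩
    rw [rf t htD, rg t htD, rs t htD, rf x hxD, rg x hxD, rs x hxD, h1, h2, h3, h4]
    refine ⟨rfl, rfl, ?_⟩
    push_cast
    ring
  · intro hxb
    have hxd : x < min b (x + δ) := lt_min hxb (by linarith)
    have hsub : Set.Ico x (min b (x + δ)) ⊆ D := by
      intro t ht
      have h1 := ht.2.trans_le (min_le_left b (x + δ))
      have h2 := ht.2.trans_le (min_le_right b (x + δ))
      exact ⟨⟨by linarith [ht.1], h2⟩, ⟨hx.1.trans ht.1, h1.le⟩⟩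
    have hfil : nhdsWithin x (Set.Ioi x) ≤ nhdsWithin x (Set.Icc a b) := by
      rw [← nhdsWithin_Ioo_eq_nhdsGT hxd]
      exact nhdsWithin_mono _ fun t ht => hDI (hsub ⟨ht.1.le, ht.2⟩)
    have L := fun c hc hRc => local_right X (X c) _ x hxd (fun t ht => sy c hc hRc t (hsub ht))
      (fun s h1 t h2 hst v => mono v (hsub h1) (hsub h2) hst) (hXc.mono_left hfil)
    obtain ⟨qb, Pb, pb⟩ := L b hb hRb
    obtain ⟨qa, Pa, pa⟩ := L a ha hRa
    refine ⟨pidx (qf (X b - X x)) + Pb, pidx (qf (X a - X x)) + Pa, ?_⟩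
    filter_upwards [pb, qb, pa, qa, Ioo_mem_nhdsGT hxd] with t h1 h2 h3 h4 ht
    have htD := hsub ⟨ht.1.le, ht.2⟩
    rw [rf t htD, rg t htD, rs t htD, rs x hxD, h1, h2, h3, h4]
    exact ⟨rfl, rfl, rfl⟩

/-- `Σ_{a<ν≤b} ρ_{W(b)}(W(ν)) − Σ_{a<ν≤b} ρ_{W(a)}(W(ν)) = rank(W(b)−W(a))`,
where `ρ_{Ŵ}(W(ν)) = rank(Ŵ−W(ν⁻)) − rank(Ŵ−W(ν))`; the jump sets are finite. -/
theorem statement15 (n : ℕ) (a b : ℝ) (hab : a ≤ b)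
    (W W' : ℝ → Matrix (Fin n ⊕ Fin n) (Fin n ⊕ Fin n) ℝ)
    (hW : ∀ l ∈ Set.Icc a b, IsSymplectic (W l))
    (hd : ∀ l ∈ Set.Icc a b, ∀ i j,
      HasDerivWithinAt (fun t => W t i j) (W' l i j) (Set.Icc a b) l)
    (hmon : ∀ l ∈ Set.Icc a b, ((Jmat (Fin n))ᵀ * W' l * (W l)⁻¹).PosSemidef) :
    {x ∈ Set.Ioc a b | jmp (fun t => (W b - W t).rank) x ≠ 0}.Finite ∧
    {x ∈ Set.Ioc a b | jmp (fun t => (W a - W t).rank) x ≠ 0}.Finite ∧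
    (∑ᶠ x ∈ Set.Ioc a b, jmp (fun t => (W b - W t).rank) x)
      - (∑ᶠ x ∈ Set.Ioc a b, jmp (fun t => (W a - W t).rank) x)
      = ((W b - W a).rank : ℤ) := by
  have ha : a ∈ Set.Icc a b := ⟨le_rfl, hab⟩
  have hb : b ∈ Set.Icc a b := ⟨hab, le_rfl⟩
  have loc := local_data n a b hab W W' hW hd hmon _ _ _ rfl rfl rfl
  obtain ⟨h1, h2, h3⟩ := intP_global hab (fun x hx => (loc x hx).1) (fun x hx => (loc x hx).2)
  refine ⟨h1, h2, h3.trans ?_⟩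
  obtain ⟨R, hR, hRa, hRb, -⟩ := exists_R (W a) (W b) (W b) (hW a ha) (hW b hb) (hW b hb)
  beta_reduce
  rw [kash_pidx hR (hW a ha) (hW b hb) (hW a ha) hRa hRb hRa,
    kash_pidx hR (hW b hb) (hW b hb) (hW a ha) hRb hRb hRa, sub_self, sub_self, sub_self, rank_zero]
  push_cast
  ring
end
end
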